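/- arXiv:1807.05624 — 5 statements merged into one kernel-verified Lean document; each statement's English description precedes it below -/
import Mathlib

section
/- Let J be a basic cylinder in M_a and let p = (p₁,p₂,…) be an element of J. Then for each i ∈ ℕ: i ∉ Λ(J) if and only if xᵢ = pᵢ for every x = (x₁,x₂,…) ∈ GS(J,p). -/
open Filter

noncomputable section

/-- Fix a sequence `a` of positive reals with `∑ aᵢ² < ∞`.  The space
`M_a` consists of the real sequences `x` with `∑ aᵢ² xᵢ² < ∞`. -/
def Ma (a : ℕ → ℝ) : Set (ℕ → ℝ) := {x | Summable fun i => (a i) ^ 2 * (x i) ^ 2}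

/-- The inner product `⟨x,y⟩_a = ∑ aᵢ² xᵢ yᵢ` on `M_a`. -/
def innerA (a : ℕ → ℝ) (x y : ℕ → ℝ) : ℝ := ∑' i, (a i) ^ 2 * (x i * y i)

/-- The metric `d_a(x,y) = (∑ aᵢ² (xᵢ - yᵢ)²)^{1/2}`. -/
def da (a : ℕ → ℝ) (x y : ℕ → ℝ) : ℝ := Real.sqrt (∑' i, (a i) ^ 2 * (x i - y i) ^ 2)

/-- `eᵢ`: the sequence with `1` in the `i`-th coordinate and `0` elsewhere. -/
def eSeq (i : ℕ) : ℕ → ℝ := Pi.single i 1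

/-- `Λ(E) = {i | ∃ x ∈ E, ∃ α ≠ 0, x + α eᵢ ∈ E}`. -/
def Lam (E : Set (ℕ → ℝ)) : Set ℕ :=
  {i | ∃ x ∈ E, ∃ α : ℝ, α ≠ 0 ∧ x + α • eSeq i ∈ E}

/-- Convergence of the series `∑ᵢ f i` to `s` in `M_a`: the partial sums
converge to `s` with respect to the metric `d_a`. -/
def ConvSeries (a : ℕ → ℝ) (f : ℕ → ℕ → ℝ) (s : ℕ → ℝ) : Prop :=
  Tendsto (fun n => da a (∑ i ∈ Finset.range n, f i) s) atTop (nhds 0)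

/-- The generalized linear span `GS(E,p)`: all points `p + ∑ᵢ αᵢ (xᵢ - p) ∈ M_a`
with `xᵢ ∈ E`, `αᵢ ∈ ℝ`, the series converging in `M_a`. -/
def GS (a : ℕ → ℝ) (E : Set (ℕ → ℝ)) (p : ℕ → ℝ) : Set (ℕ → ℝ) :=
  {u | u ∈ Ma a ∧ ∃ x : ℕ → ℕ → ℝ, ∃ α : ℕ → ℝ,
    (∀ i, x i ∈ E) ∧ ConvSeries a (fun i => α i • (x i - p)) (u - p)}

/-- `E` is a `d_a`-bounded set. -/
def BoundedA (a : ℕ → ℝ) (E : Set (ℕ → ℝ)) : Prop :=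
  ∃ C : ℝ, ∀ x ∈ E, ∀ y ∈ E, da a x y ≤ C

/-- `f` is a `d_a`-isometry on `E`. -/
def IsIsomOn (a : ℕ → ℝ) (f : (ℕ → ℝ) → ℕ → ℝ) (E : Set (ℕ → ℝ)) : Prop :=
  ∀ x ∈ E, ∀ y ∈ E, da a (f x) (f y) = da a x y

/-- Data for a basic cylinder: each factor is a nonempty closed subinterval
`[lo i, hi i] ⊆ [0,1]`, and all but finitely many factors equal `[0,1]`. -/
def IsBCData (lo hi : ℕ → ℝ) : Prop :=
  (∀ i, 0 ≤ lo i) ∧ (∀ i, lo i ≤ hi i) ∧ (∀ i, hi i ≤ 1) ∧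
    {i | ¬(lo i = 0 ∧ hi i = 1)}.Finite

/-- The product set `∏ᵢ [lo i, hi i]`. -/
def cylSet (lo hi : ℕ → ℝ) : Set (ℕ → ℝ) := {x | ∀ i, x i ∈ Set.Icc (lo i) (hi i)}

/-- `J` is a basic cylinder. -/
def IsBasicCylinder (J : Set (ℕ → ℝ)) : Prop :=
  ∃ lo hi : ℕ → ℝ, IsBCData lo hi ∧ J = cylSet lo hi

/-- The elementary volume of a basic cylinder: the product of the lengths of its
edges (a finite product; it is `0` exactly when some factor is a singleton). -/
def bcVol (lo hi : ℕ → ℝ) : ℝ := ∏ᶠ i, (hi i - lo i)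

/-- `K` is a cylinder of volume `v`: there are a basic cylinder of elementary
volume `v` and a surjective `d_a`-isometry from it onto `K`. -/
def IsCylVol (a : ℕ → ℝ) (K : Set (ℕ → ℝ)) (v : ℝ) : Prop :=
  ∃ lo hi : ℕ → ℝ, IsBCData lo hi ∧ v = bcVol lo hi ∧
    ∃ f : (ℕ → ℝ) → ℕ → ℝ, IsIsomOn a f (cylSet lo hi) ∧ f '' cylSet lo hi = K

/-- `K` is a cylinder. -/
def IsCylinder (a : ℕ → ℝ) (K : Set (ℕ → ℝ)) : Prop := ∃ v : ℝ, IsCylVol a K v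

/-- The `d_a`-diameter of a set. -/
def daDiam (a : ℕ → ℝ) (K : Set (ℕ → ℝ)) : ℝ := sSup (Set.image2 (da a) K K)

/-- `μ_δ(E)`: the infimum of `∑ vol(Kᵢ)` over countable coverings of `E` by
cylinders of `d_a`-diameter `< δ` (`∞` if no such covering exists). -/
def preMu (a : ℕ → ℝ) (δ : ℝ) (E : Set (ℕ → ℝ)) : ENNReal :=
  sInf {m : ENNReal | ∃ (K : ℕ → Set (ℕ → ℝ)) (v : ℕ → ℝ),
    (∀ n, IsCylVol a (K n) (v n)) ∧ (∀ n, daDiam a (K n) < δ) ∧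
    (E ⊆ ⋃ n, K n) ∧ m = ∑' n, ENNReal.ofReal (v n)}

/-- The outer measure `μ(E) = lim_{δ→0⁺} μ_δ(E) = sup_{δ>0} μ_δ(E)`. -/
def muA (a : ℕ → ℝ) (E : Set (ℕ → ℝ)) : ENNReal :=
  ⨆ (δ : ℝ) (_ : 0 < δ), preMu a δ E

/-- The Hilbert cube `I^ω = [0,1]^ℕ`, viewed as a subset of `M_a`. -/
def cube : Set (ℕ → ℝ) := {x | ∀ i, x i ∈ Set.Icc (0 : ℝ) 1}

theorem add_mem_Ma {a x y : ℕ → ℝ} (hx : x ∈ Ma a) (hy : y ∈ Ma a) : x + y ∈ Ma a := by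
  have h : Summable fun i => 2 * ((a i) ^ 2 * (x i) ^ 2) + 2 * ((a i) ^ 2 * (y i) ^ 2) :=
    (Summable.mul_left 2 hx).add (Summable.mul_left 2 hy)
  refine Summable.of_nonneg_of_le (fun i => by positivity) (fun i => ?_) h
  rw [Pi.add_apply]
  nlinarith [mul_nonneg (sq_nonneg (a i)) (sq_nonneg (x i - y i))]

theorem smul_mem_Ma {a x : ℕ → ℝ} (c : ℝ) (hx : x ∈ Ma a) : c • x ∈ Ma a := by
  refine (Summable.mul_left (c ^ 2) hx).congr fun i => ?_
  rw [Pi.smul_apply, smul_eq_mul]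
  ring

theorem sub_mem_Ma {a x y : ℕ → ℝ} (hx : x ∈ Ma a) (hy : y ∈ Ma a) : x - y ∈ Ma a := by
  simpa [sub_eq_add_neg] using add_mem_Ma hx (smul_mem_Ma (-1) hy)

theorem zero_mem_Ma (a : ℕ → ℝ) : (0 : ℕ → ℝ) ∈ Ma a := by
  simp [Ma, summable_zero]

theorem sum_mem_Ma {a : ℕ → ℝ} {ι : Type*} (s : Finset ι) {f : ι → ℕ → ℝ}
    (hf : ∀ i ∈ s, f i ∈ Ma a) : ∑ i ∈ s, f i ∈ Ma a :=
  Finset.sum_induction f (· ∈ Ma a) (fun _ _ => add_mem_Ma) (zero_mem_Ma a) hf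

theorem cylSet_subset_Ma {a lo hi : ℕ → ℝ} (hsum : Summable fun i => (a i) ^ 2)
    (hJ : IsBCData lo hi) : cylSet lo hi ⊆ Ma a := by
  intro x hx
  refine Summable.of_nonneg_of_le (fun i => by positivity) (fun i => ?_) hsum
  have h0 : 0 ≤ x i := (hJ.1 i).trans (hx i).1
  have h1 : x i ≤ 1 := (hx i).2.trans (hJ.2.2.1 i)
  exact mul_le_of_le_one_right (sq_nonneg _) (pow_le_one₀ h0 h1)

theorem mul_abs_sub_le_da {a x y : ℕ → ℝ} (hx : x ∈ Ma a) (hy : y ∈ Ma a) (i : ℕ) :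
    |a i * (x i - y i)| ≤ da a x y := by
  refine Real.abs_le_sqrt ?_
  rw [mul_pow]
  exact (sub_mem_Ma hx hy).le_tsum i fun j _ => by positivity

/-- Every point of `E ∩ M_a` lies in the generalized linear span of `E`. -/
theorem mem_GS_of_mem {a p u : ℕ → ℝ} {E : Set (ℕ → ℝ)} (hu : u ∈ E) (hua : u ∈ Ma a) :
    u ∈ GS a E p := by
  refine ⟨hua, fun _ => u, Pi.single 0 1, fun _ => hu, ?_⟩
  refine tendsto_const_nhds.congr' ?_
  filter_upwards [eventually_ge_atTop 1] with n hn
  have h : ∑ i ∈ Finset.range n, (Pi.single 0 1 : ℕ → ℝ) i • (u - p) = u - p := by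
    rw [← Finset.sum_smul, Finset.sum_pi_single', if_pos (Finset.mem_range.2 hn), one_smul]
  rw [h]
  simp [da]

/-- The generalized linear span is constant in a coordinate in which `E` is constant. -/
theorem apply_eq_of_mem_GS {a p u : ℕ → ℝ} {E : Set (ℕ → ℝ)} (hE : E ⊆ Ma a) (hp : p ∈ E)
    {i : ℕ} (hi : a i ≠ 0) (hEi : ∀ x ∈ E, x i = p i) (hu : u ∈ GS a E p) : u i = p i := by
  obtain ⟨hua, x, α, hx, hconv⟩ := hu
  have hle : |a i * (0 - (u - p) i)| ≤ 0 := by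
    refine ge_of_tendsto' hconv fun n => ?_
    have hS : (∑ j ∈ Finset.range n, α j • (x j - p)) ∈ Ma a :=
      sum_mem_Ma _ fun j _ => smul_mem_Ma _ (sub_mem_Ma (hE (hx j)) (hE hp))
    have h0 : (∑ j ∈ Finset.range n, α j • (x j - p)) i = 0 := by
      rw [Finset.sum_apply]
      exact Finset.sum_eq_zero fun j _ => by simp [hEi _ (hx j)]
    simpa only [h0] using mul_abs_sub_le_da hS (sub_mem_Ma hua (hE hp)) i
  have h := abs_nonpos_iff.1 hle
  rw [mul_eq_zero, or_iff_right hi, zero_sub, neg_eq_zero, Pi.sub_apply] at h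
  exact sub_eq_zero.1 h

theorem update_mem_cylSet {lo hi p : ℕ → ℝ} (hp : p ∈ cylSet lo hi) {i : ℕ} {c : ℝ}
    (hc : c ∈ Set.Icc (lo i) (hi i)) : Function.update p i c ∈ cylSet lo hi := by
  intro j
  obtain rfl | hj := eq_or_ne j i
  · simpa using hc
  · simpa [hj] using hp j

theorem notMem_Lam_cylSet_iff {lo hi p : ℕ → ℝ} (hp : p ∈ cylSet lo hi) (i : ℕ) :
    i ∉ Lam (cylSet lo hi) ↔ ∀ x ∈ cylSet lo hi, x i = p i := by
  constructor
  · intro h x hx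
    by_contra hne
    refine h ⟨p, hp, x i - p i, sub_ne_zero.2 hne, ?_⟩
    convert update_mem_cylSet hp (hx i) using 1
    ext j
    obtain rfl | hj := eq_or_ne j i
    · simp [eSeq]
    · simp [eSeq, hj]
  · rintro h ⟨x, hx, α, hα, hxα⟩
    have h1 := h _ hxα
    rw [Pi.add_apply, h x hx] at h1
    exact hα (by simpa [eSeq] using h1)

/-- Let `J` be a basic cylinder and `p ∈ J`.  Then `i ∉ Λ(J)` iff `xᵢ = pᵢ`
for every `x ∈ GS(J,p)`. -/
theorem ulam_stmt1 (a : ℕ → ℝ) (ha : ∀ i, 0 < a i)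
    (hsum : Summable fun i => (a i) ^ 2)
    (lo hi : ℕ → ℝ) (hJ : IsBCData lo hi)
    (p : ℕ → ℝ) (hp : p ∈ cylSet lo hi) (i : ℕ) :
    i ∉ Lam (cylSet lo hi) ↔ ∀ x ∈ GS a (cylSet lo hi) p, x i = p i := by
  rw [notMem_Lam_cylSet_iff hp]
  have hE := cylSet_subset_Ma hsum hJ
  exact ⟨fun h x hx => apply_eq_of_mem_GS hE hp (ha i).ne' h hx,
    fun h x hx => h x (mem_GS_of_mem hx (hE hx))⟩
end
end

section
/- Let E₁ and E₂ be nonempty bounded subsets of M_a, f : E₁ → E₂ a surjective d_a-isometry, p ∈ E₁ and q = f(p). Then: (1) for any countable family (xᵢ) in E₁ and reals (αᵢ) such that the series ∑ᵢ αᵢ(xᵢ − p) converges in M_a, the series ∑ᵢ αᵢ(f(xᵢ) − q) also converges in M_a; and (2) if (xᵢ), (yᵢ) are countable families in E₁ and (αᵢ), (βᵢ) are reals with ∑ᵢ αᵢ(xᵢ − p) = ∑ᵢ βᵢ(yᵢ − p) (both series converging in M_a), then ∑ᵢ αᵢ(f(xᵢ) − q) = ∑ᵢ βᵢ(f(yᵢ)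 − q). -/
open Filter

noncomputable section

section GramEquality

variable {ι H K : Type*} [NormedAddCommGroup H] [InnerProductSpace ℝ H]
  [NormedAddCommGroup K] [InnerProductSpace ℝ K]

/-- Families with equal Gram matrices have linear combinations of equal norm. -/
theorem norm_sum_smul_eq_of_inner_eq {u : ι → H} {v : ι → K}
    (h : ∀ i j, inner ℝ (u i) (u j) = inner ℝ (v i) (v j)) (s : Finset ι) (c : ι → ℝ) :
    ‖∑ i ∈ s, c i • u i‖ = ‖∑ i ∈ s, c i • v i‖ := by
  have key : ‖∑ i ∈ s, c i • u i‖ ^ 2 = ‖∑ i ∈ s, c i • v i‖ ^ 2 := by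
    simp only [← real_inner_self_eq_norm_sq, sum_inner, inner_sum, real_inner_smul_left,
      real_inner_smul_right, h]
  exact (sq_eq_sq₀ (norm_nonneg _) (norm_nonneg _)).1 key

theorem inner_sub_sub_eq_of_norm_sub_eq {x y p : H} {x' y' p' : K}
    (hx : ‖x - p‖ = ‖x' - p'‖) (hy : ‖y - p‖ = ‖y' - p'‖) (hxy : ‖x - y‖ = ‖x' - y'‖) :
    inner ℝ (x - p) (y - p) = inner ℝ (x' - p') (y' - p') := by
  have h := norm_sub_sq_real (x - p) (y - p)
  have h' := norm_sub_sq_real (x' - p') (y' - p')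
  rw [sub_sub_sub_cancel_right] at h h'
  rw [hx, hy, hxy] at h
  linarith

theorem cauchySeq_sum_smul_of_inner_eq {u : ℕ → H} {v : ℕ → K}
    (h : ∀ i j, inner ℝ (u i) (u j) = inner ℝ (v i) (v j)) {c : ℕ → ℝ}
    (hc : CauchySeq fun n => ∑ i ∈ Finset.range n, c i • u i) :
    CauchySeq fun n => ∑ i ∈ Finset.range n, c i • v i := by
  have dist_eq : ∀ m n, m ≤ n →
      dist (∑ i ∈ Finset.range m, c i • v i) (∑ i ∈ Finset.range n, c i • v i) =
        dist (∑ i ∈ Finset.range m, c i • u i) (∑ i ∈ Finset.range n, c i • u i) := by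
    intro m n hmn
    rw [dist_comm, dist_eq_norm, dist_comm, dist_eq_norm, ← Finset.sum_Ico_eq_sub _ hmn,
      ← Finset.sum_Ico_eq_sub _ hmn, norm_sum_smul_eq_of_inner_eq h]
  rw [Metric.cauchySeq_iff] at hc ⊢
  intro ε hε
  obtain ⟨N, hN⟩ := hc ε hε
  refine ⟨N, fun m hm n hn => ?_⟩
  rcases le_total m n with hmn | hmn
  · rw [dist_eq m n hmn]
    exact hN m hm n hn
  · rw [dist_comm, dist_eq n m hmn]
    exact hN n hn m hm

theorem eq_of_tendsto_sum_smul_of_inner_eq {u u' : ℕ → H} {v v' : ℕ → K}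
    (h : ∀ i j, inner ℝ (Sum.elim u u' i) (Sum.elim u u' j) =
      inner ℝ (Sum.elim v v' i) (Sum.elim v v' j))
    {c c' : ℕ → ℝ} {s : H} {t t' : K}
    (hu : Tendsto (fun n => ∑ i ∈ Finset.range n, c i • u i) atTop (nhds s))
    (hu' : Tendsto (fun n => ∑ i ∈ Finset.range n, c' i • u' i) atTop (nhds s))
    (hv : Tendsto (fun n => ∑ i ∈ Finset.range n, c i • v i) atTop (nhds t))
    (hv' : Tendsto (fun n => ∑ i ∈ Finset.range n, c' i • v' i) atTop (nhds t')) :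
    t = t' := by
  have norm_eq : ∀ n,
      ‖∑ i ∈ Finset.range n, c i • u i - ∑ i ∈ Finset.range n, c' i • u' i‖ =
        ‖∑ i ∈ Finset.range n, c i • v i - ∑ i ∈ Finset.range n, c' i • v' i‖ := by
    intro n
    have := norm_sum_smul_eq_of_inner_eq h ((Finset.range n).disjSum (Finset.range n))
      (Sum.elim c (-c'))
    simpa [Finset.sum_disjSum, ← sub_eq_add_neg] using this
  have hs := (hu.sub hu').norm
  simp only [norm_eq] at hs
  have ht := tendsto_nhds_unique (hv.sub hv').norm hs
  rw [sub_self, norm_zero, norm_eq_zero] at ht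
  exact sub_eq_zero.1 ht

end GramEquality

theorem mem_Ma_iff_memlp {a x : ℕ → ℝ} : x ∈ Ma a ↔ Memℓp (fun i => a i * x i) 2 := by
  rw [memℓp_gen_iff (by norm_num)]
  simp [Ma, mul_pow]

/-- `M_a` as a linear subspace of the space of all real sequences. -/
def maSubmodule (a : ℕ → ℝ) : Submodule ℝ (ℕ → ℝ) where
  carrier := Ma a
  zero_mem' := by simp [Ma, summable_zero]
  add_mem' {x y} hx hy := by
    rw [mem_Ma_iff_memlp] at *
    simpa [mul_add, Pi.add_def] using hx.add hy
  smul_mem' c x hx := by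
    rw [mem_Ma_iff_memlp] at *
    simpa [mul_left_comm, Pi.smul_def] using hx.const_smul c

/-- The isometry `x ↦ (aᵢ xᵢ)ᵢ` from `M_a` to `ℓ²`. -/
def maToL2 (a : ℕ → ℝ) : maSubmodule a →ₗ[ℝ] lp (fun _ : ℕ => ℝ) 2 where
  toFun x := ⟨fun i => a i * x.1 i, mem_Ma_iff_memlp.1 x.2⟩
  map_add' x y := by
    ext i
    exact mul_add _ _ _
  map_smul' c x := by
    ext i
    simp [mul_left_comm]

@[simp]
theorem maToL2_apply (a : ℕ → ℝ) (x : maSubmodule a) (i : ℕ) : maToL2 a x i = a i * x.1 i := rfl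

theorem maToL2_injective {a : ℕ → ℝ} (ha : ∀ i, 0 < a i) : Function.Injective (maToL2 a) := by
  intro x y h
  ext i
  have hi : maToL2 a x i = maToL2 a y i := by rw [h]
  simpa [(ha i).ne'] using hi

theorem maToL2_surjective {a : ℕ → ℝ} (ha : ∀ i, 0 < a i) : Function.Surjective (maToL2 a) := by
  intro z
  have hz : (fun i => a i * (z i / a i)) = z := funext fun i => mul_div_cancel₀ _ (ha i).ne'
  refine ⟨⟨fun i => z i / a i, mem_Ma_iff_memlp.2 ?_⟩, ?_⟩
  · rw [hz]
    exact z.2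
  · ext i
    exact congrFun hz i

theorem da_eq_norm (a : ℕ → ℝ) (x y : maSubmodule a) :
    da a x y = ‖maToL2 a x - maToL2 a y‖ := by
  rw [← map_sub, lp.norm_eq_tsum_rpow (by norm_num), da, Real.sqrt_eq_rpow]
  simp [← mul_sub, mul_pow]

theorem convSeries_iff_tendsto (a : ℕ → ℝ) (α : ℕ → ℝ) (x : ℕ → maSubmodule a)
    (p s : maSubmodule a) :
    ConvSeries a (fun i => α i • ((x i : ℕ → ℝ) - p)) s ↔
      Tendsto (fun n => ∑ i ∈ Finset.range n, α i • (maToL2 a (x i) - maToL2 a p)) atTop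
        (nhds (maToL2 a s)) := by
  rw [tendsto_iff_norm_sub_tendsto_zero, ConvSeries]
  refine tendsto_congr fun n => ?_
  have := da_eq_norm a (∑ i ∈ Finset.range n, α i • (x i - p)) s
  simpa using this

/-- (1) If `∑ αᵢ (xᵢ - p)` converges in `M_a` then so does `∑ αᵢ (f xᵢ - q)`;
(2) if two such series have the same sum, so do the transformed series. -/
theorem ulam_stmt4 (a : ℕ → ℝ) (ha : ∀ i, 0 < a i)
    (hsum : Summable fun i => (a i) ^ 2)
    (E₁ E₂ : Set (ℕ → ℝ))
    (hne₁ : E₁.Nonempty) (hM₁ : E₁ ⊆ Ma a) (hb₁ : BoundedA a E₁)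
    (hne₂ : E₂.Nonempty) (hM₂ : E₂ ⊆ Ma a) (hb₂ : BoundedA a E₂)
    (f : (ℕ → ℝ) → ℕ → ℝ) (hf : IsIsomOn a f E₁) (hfs : f '' E₁ = E₂)
    (p : ℕ → ℝ) (hp : p ∈ E₁) :
    (∀ (x : ℕ → ℕ → ℝ) (α : ℕ → ℝ), (∀ i, x i ∈ E₁) →
       (∃ s ∈ Ma a, ConvSeries a (fun i => α i • (x i - p)) s) →
       ∃ t ∈ Ma a, ConvSeries a (fun i => α i • (f (x i) - f p)) t) ∧
    (∀ (x y : ℕ → ℕ → ℝ) (α β : ℕ → ℝ) (s : ℕ → ℝ),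
       (∀ i, x i ∈ E₁) → (∀ i, y i ∈ E₁) → s ∈ Ma a →
       ConvSeries a (fun i => α i • (x i - p)) s →
       ConvSeries a (fun i => β i • (y i - p)) s →
       ∀ t₁ t₂ : ℕ → ℝ, t₁ ∈ Ma a → t₂ ∈ Ma a →
         ConvSeries a (fun i => α i • (f (x i) - f p)) t₁ →
         ConvSeries a (fun i => β i • (f (y i) - f p)) t₂ → t₁ = t₂) := by
  have hfM : ∀ x ∈ E₁, f x ∈ Ma a := fun x hx => hM₂ (hfs ▸ Set.mem_image_of_mem f hx)
  have norm_eq : ∀ x (hx : x ∈ E₁) y (hy : y ∈ E₁),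
      ‖maToL2 a ⟨x, hM₁ hx⟩ - maToL2 a ⟨y, hM₁ hy⟩‖ =
        ‖maToL2 a ⟨f x, hfM x hx⟩ - maToL2 a ⟨f y, hfM y hy⟩‖ := by
    intro x hx y hy
    rw [← da_eq_norm, ← da_eq_norm]
    exact (hf x hx y hy).symm
  have inner_eq : ∀ x (hx : x ∈ E₁) y (hy : y ∈ E₁),
      inner ℝ (maToL2 a ⟨x, hM₁ hx⟩ - maToL2 a ⟨p, hM₁ hp⟩)
          (maToL2 a ⟨y, hM₁ hy⟩ - maToL2 a ⟨p, hM₁ hp⟩) =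
        inner ℝ (maToL2 a ⟨f x, hfM x hx⟩ - maToL2 a ⟨f p, hfM p hp⟩)
          (maToL2 a ⟨f y, hfM y hy⟩ - maToL2 a ⟨f p, hfM p hp⟩) := fun x hx y hy =>
    inner_sub_sub_eq_of_norm_sub_eq (norm_eq x hx p hp) (norm_eq y hy p hp) (norm_eq x hx y hy)
  have conv_iff := fun (x : ℕ → ℕ → ℝ) (hx : ∀ i, x i ∈ E₁) (α s : ℕ → ℝ) (hs : s ∈ Ma a) =>
    convSeries_iff_tendsto a α (fun i => ⟨x i, hM₁ (hx i)⟩) ⟨p, hM₁ hp⟩ ⟨s, hs⟩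
  have conv_iff' := fun (x : ℕ → ℕ → ℝ) (hx : ∀ i, x i ∈ E₁) (α t : ℕ → ℝ) (ht : t ∈ Ma a) =>
    convSeries_iff_tendsto a α (fun i => ⟨f (x i), hfM _ (hx i)⟩) ⟨f p, hfM p hp⟩ ⟨t, ht⟩
  refine ⟨?_, ?_⟩
  · rintro x α hx ⟨s, hs, hconv⟩
    obtain ⟨z, hz⟩ := cauchySeq_tendsto_of_complete
      (cauchySeq_sum_smul_of_inner_eq (fun i j => inner_eq (x i) (hx i) (x j) (hx j))
        ((conv_iff x hx α s hs).1 hconv).cauchySeq)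
    obtain ⟨t, rfl⟩ := maToL2_surjective ha z
    exact ⟨t, t.2, (conv_iff' x hx α t t.2).2 hz⟩
  · intro x y α β s hx hy hs hxs hys t₁ t₂ ht₁ ht₂ hxt hyt
    have ht := eq_of_tendsto_sum_smul_of_inner_eq
      (by rintro (i | i) (j | j) <;> apply inner_eq <;> simp only [hx, hy])
      ((conv_iff x hx α s hs).1 hxs) ((conv_iff y hy β s hs).1 hys)
      ((conv_iff' x hx α t₁ ht₁).1 hxt) ((conv_iff' y hy β t₂ ht₂).1 hyt)
    exact congrArg Subtype.val (maToL2_injective ha ht)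
end
end

section
/- Let E₁ and E₂ be nonempty bounded subsets of M_a, f : E₁ → E₂ a surjective d_a-isometry, p ∈ E₁ and q = f(p). Then there exists a d_a-isometry F : GS(E₁,p) → M_a extending f (i.e., F(x) = f(x) for all x ∈ E₁) such that for every countable family (xᵢ) in E₁ and reals (αᵢ) with u = p + ∑ᵢ αᵢ(xᵢ − p) ∈ M_a, one has F(u) = q + ∑ᵢ αᵢ(f(xᵢ) − q). -/
open Filter

noncomputable section

/-- The linear map `v ↦ (vᵢ / aᵢ)ᵢ` from `ℓ²` to sequences; it identifies `ℓ²` with `M_a`. -/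
def ellTwoToSeq (a : ℕ → ℝ) : lp (fun _ : ℕ => ℝ) 2 →ₗ[ℝ] (ℕ → ℝ) where
  toFun v i := v i / a i
  map_add' v w := by ext i; simp [add_div]
  map_smul' c v := by ext i; simp [mul_div_assoc]

theorem ellTwoToSeq_apply (a : ℕ → ℝ) (v : lp (fun _ : ℕ => ℝ) 2) (i : ℕ) :
    ellTwoToSeq a v i = v i / a i := rfl

theorem da_ellTwoToSeq {a : ℕ → ℝ} (ha : ∀ i, 0 < a i) (v w : lp (fun _ : ℕ => ℝ) 2) :
    da a (ellTwoToSeq a v) (ellTwoToSeq a w) = ‖v - w‖ := by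
  have h : ‖v - w‖ ^ 2 = ∑' i, (a i) ^ 2 * (ellTwoToSeq a v i - ellTwoToSeq a w i) ^ 2 := by
    have h2 := lp.norm_rpow_eq_tsum (p := 2) (by norm_num) (v - w)
    simp only [ENNReal.toReal_ofNat, Real.rpow_ofNat, Real.norm_eq_abs, sq_abs] at h2
    rw [h2]
    refine tsum_congr fun i => ?_
    have := (ha i).ne'
    simp only [ellTwoToSeq_apply, lp.coeFn_sub, Pi.sub_apply]
    field_simp
  rw [da, ← h, Real.sqrt_sq (norm_nonneg _)]

theorem ellTwoToSeq_mem {a : ℕ → ℝ} (ha : ∀ i, 0 < a i) (v : lp (fun _ : ℕ => ℝ) 2) :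
    ellTwoToSeq a v ∈ Ma a := by
  have h := (lp.memℓp v).summable (by norm_num)
  simp only [ENNReal.toReal_ofNat, Real.rpow_ofNat, Real.norm_eq_abs, sq_abs] at h
  refine h.congr fun i => ?_
  have := (ha i).ne'
  simp only [ellTwoToSeq_apply]
  field_simp

theorem exists_ellTwoToSeq_eq {a : ℕ → ℝ} (ha : ∀ i, 0 < a i) {x : ℕ → ℝ} (hx : x ∈ Ma a) :
    ∃ v, ellTwoToSeq a v = x := by
  refine ⟨⟨fun i => a i * x i, memℓp_gen ?_⟩, ?_⟩
  · simpa [mul_pow, Ma] using hx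
  · ext i
    exact mul_div_cancel_left₀ _ (ha i).ne'

theorem ellTwoToSeq_injective {a : ℕ → ℝ} (ha : ∀ i, 0 < a i) :
    Function.Injective (ellTwoToSeq a) := by
  intro v w h
  ext i
  exact (div_left_inj' (ha i).ne').1 (congrFun h i)

section LinearCombination

variable {ι H K : Type*} [NormedAddCommGroup H] [InnerProductSpace ℝ H]
  [NormedAddCommGroup K] [InnerProductSpace ℝ K]

open Finsupp in
theorem norm_linearCombination_eq_of_inner_eq {x : ι → H} {y : ι → K}
    (h : ∀ i j, inner ℝ (x i) (x j) = inner ℝ (y i) (y j)) (c : ι →₀ ℝ) :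
    ‖linearCombination ℝ x c‖ = ‖linearCombination ℝ y c‖ := by
  refine (sq_eq_sq₀ (norm_nonneg _) (norm_nonneg _)).1 ?_
  simp only [← real_inner_self_eq_norm_sq, linearCombination_apply, Finsupp.sum, sum_inner,
    inner_sum, real_inner_smul_left, real_inner_smul_right, h]

theorem inner_eq_of_norm_eq_of_norm_sub_eq {x x' : H} {y y' : K} (h : ‖x‖ = ‖y‖)
    (h' : ‖x'‖ = ‖y'‖) (hsub : ‖x - x'‖ = ‖y - y'‖) : inner ℝ x x' = inner ℝ y y' := by
  simp only [real_inner_eq_norm_mul_self_add_norm_mul_self_sub_norm_sub_mul_self_div_two,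
    h, h', hsub]

open Finsupp in
/-- If `x` and `y` have the same Gram matrix, then sending limits of linear combinations of `x` to
limits of the corresponding linear combinations of `y` is well defined. -/
theorem exists_forall_tendsto_linearCombination [CompleteSpace K] {x : ι → H} {y : ι → K}
    (h : ∀ i j, inner ℝ (x i) (x j) = inner ℝ (y i) (y j)) :
    ∃ G : H → K, ∀ (c : ℕ → ι →₀ ℝ) (w : H),
      Tendsto (fun n => linearCombination ℝ x (c n)) atTop (nhds w) →
      Tendsto (fun n => linearCombination ℝ y (c n)) atTop (nhds (G w)) := by
  have hn := norm_linearCombination_eq_of_inner_eq h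
  suffices ∀ w : H, ∃ z : K, ∀ c : ℕ → ι →₀ ℝ,
      Tendsto (fun n => linearCombination ℝ x (c n)) atTop (nhds w) →
      Tendsto (fun n => linearCombination ℝ y (c n)) atTop (nhds z) by
    choose G hG using this
    exact ⟨G, fun c w => hG w c⟩
  intro w
  by_cases hw : ∃ c : ℕ → ι →₀ ℝ, Tendsto (fun n => linearCombination ℝ x (c n)) atTop (nhds w)
  · obtain ⟨c, hc⟩ := hw
    have hcauchy : CauchySeq fun n => linearCombination ℝ y (c n) := by
      have := hc.cauchySeq
      rw [Metric.cauchySeq_iff] at this ⊢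
      simpa only [dist_eq_norm, ← map_sub, hn] using this
    obtain ⟨z, hz⟩ := cauchySeq_tendsto_of_complete hcauchy
    refine ⟨z, fun d hd => ?_⟩
    have hdc : Tendsto (fun n => linearCombination ℝ y (d n - c n)) atTop (nhds 0) := by
      rw [tendsto_zero_iff_norm_tendsto_zero]
      simp only [← hn]
      rw [← tendsto_zero_iff_norm_tendsto_zero]
      simpa using hd.sub hc
    simpa using hdc.add hz
  · exact ⟨0, fun c hc => (hw ⟨c, hc⟩).elim⟩

end LinearCombination

/-- Existence of a `d_a`-isometric extension `F : GS(E₁,p) → M_a` of a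
surjective `d_a`-isometry `f : E₁ → E₂`, given by
`F(p + ∑ αᵢ(xᵢ - p)) = q + ∑ αᵢ(f xᵢ - q)`. -/
theorem ulam_stmt5 (a : ℕ → ℝ) (ha : ∀ i, 0 < a i)
    (hsum : Summable fun i => (a i) ^ 2)
    (E₁ E₂ : Set (ℕ → ℝ))
    (hne₁ : E₁.Nonempty) (hM₁ : E₁ ⊆ Ma a) (hb₁ : BoundedA a E₁)
    (hne₂ : E₂.Nonempty) (hM₂ : E₂ ⊆ Ma a) (hb₂ : BoundedA a E₂)
    (f : (ℕ → ℝ) → ℕ → ℝ) (hf : IsIsomOn a f E₁) (hfs : f '' E₁ = E₂)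
    (p : ℕ → ℝ) (hp : p ∈ E₁) :
    ∃ F : (ℕ → ℝ) → ℕ → ℝ,
      (∀ x ∈ E₁, F x = f x) ∧
      (∀ u ∈ GS a E₁ p, F u ∈ Ma a) ∧
      IsIsomOn a F (GS a E₁ p) ∧
      (∀ (x : ℕ → ℕ → ℝ) (α : ℕ → ℝ) (u : ℕ → ℝ),
        (∀ i, x i ∈ E₁) → u ∈ Ma a →
        ConvSeries a (fun i => α i • (x i - p)) (u - p) →
        ConvSeries a (fun i => α i • (f (x i) - f p)) (F u - f p)) := by
  set S := ellTwoToSeq a with hS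
  have hmap : ∀ x ∈ E₁, f x ∈ Ma a := fun x hx => hM₂ (hfs ▸ Set.mem_image_of_mem f hx)
  set R : (ℕ → ℝ) → lp (fun _ : ℕ => ℝ) 2 := Function.invFun S
  have hSR : ∀ x ∈ Ma a, S (R x) = x := fun x hx =>
    Function.invFun_eq (exists_ellTwoToSeq_eq ha hx)
  have hRS : ∀ v, R (S v) = v := Function.leftInverse_invFun (ellTwoToSeq_injective ha)
  have hda : ∀ x ∈ Ma a, ∀ y ∈ Ma a, da a x y = ‖R x - R y‖ := fun x hx y hy => by
    rw [← da_ellTwoToSeq ha, ← hS, hSR x hx, hSR y hy]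
  have hfR : ∀ x ∈ E₁, ∀ y ∈ E₁, ‖R x - R y‖ = ‖R (f x) - R (f y)‖ := fun x hx y hy => by
    rw [← hda _ (hM₁ hx) _ (hM₁ hy), ← hda _ (hmap x hx) _ (hmap y hy), hf x hx y hy]
  set X : E₁ → lp (fun _ : ℕ => ℝ) 2 := fun x => R x - R p with hX
  set Y : E₁ → lp (fun _ : ℕ => ℝ) 2 := fun x => R (f x) - R (f p) with hY
  have hXY : ∀ i j, inner ℝ (X i) (X j) = inner ℝ (Y i) (Y j) := fun i j =>
    inner_eq_of_norm_eq_of_norm_sub_eq (hfR i i.2 p hp) (hfR j j.2 p hp)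
      (by simpa [hX, hY] using hfR i i.2 j j.2)
  obtain ⟨G, hG⟩ := exists_forall_tendsto_linearCombination hXY
  have hconv : ∀ (g : (ℕ → ℝ) → ℕ → ℝ), (∀ x ∈ E₁, g x ∈ Ma a) →
      ∀ (x : ℕ → E₁) (α : ℕ → ℝ) (u : ℕ → ℝ), u ∈ Ma a →
      (ConvSeries a (fun i => α i • (g (x i) - g p)) (u - g p) ↔
        Tendsto (fun n => Finsupp.linearCombination ℝ (fun z : E₁ => R (g z) - R (g p))
          (∑ i ∈ Finset.range n, Finsupp.single (x i) (α i))) atTop (nhds (R u - R (g p)))) := by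
    intro g hg x α u hu
    rw [tendsto_iff_norm_sub_tendsto_zero, ConvSeries]
    refine iff_of_eq (congrArg (fun s => Tendsto s atTop (nhds 0)) (funext fun n => ?_))
    rw [← da_ellTwoToSeq ha, ← hS]
    simp [hSR _ hu, hSR _ (hg p hp), hSR _ (hg _ (x _).2)]
  set F : (ℕ → ℝ) → ℕ → ℝ := fun u => S (G (R u - R p) + R (f p)) with hF
  have hFmem : ∀ u, F u ∈ Ma a := fun u => ellTwoToSeq_mem ha _
  have hRF : ∀ u, R (F u) - R (f p) = G (R u - R p) := fun u => by
    rw [hF, hRS, add_sub_cancel_right]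
  refine ⟨F, fun x hx => ?_, fun u _ => hFmem u, ?_, fun x α u hx hu h => ?_⟩
  · have h := hG (fun _ => Finsupp.single ⟨x, hx⟩ 1) (R x - R p) (by simp [hX])
    have h' : G (R x - R p) = R (f x) - R (f p) := by simpa [hY, eq_comm] using h
    simp [hF, h', hSR _ (hmap x hx)]
  · rintro u ⟨hu, x, α, hx, hxu⟩ v ⟨hv, y, β, hy, hyv⟩
    have hu' := (hconv id hM₁ (fun i => ⟨x i, hx i⟩) α u hu).1 hxu
    have hv' := (hconv id hM₁ (fun i => ⟨y i, hy i⟩) β v hv).1 hyv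
    have h := ((hG _ _ hu').sub (hG _ _ hv')).norm
    simp only [← map_sub, ← norm_linearCombination_eq_of_inner_eq hXY] at h
    simp only [map_sub] at h
    have h' := tendsto_nhds_unique h (hu'.sub hv').norm
    rw [hda _ (hFmem u) _ (hFmem v), hda _ hu _ hv]
    simp only [id, ← hRF] at h'
    simpa using h'
  · have h' := (hconv id hM₁ (fun i => ⟨x i, hx i⟩) α u hu).1 h
    refine (hconv f hmap (fun i => ⟨x i, hx i⟩) α (F u) (hFmem u)).2 ?_
    rw [hRF]
    exact hG _ _ h'
end
end

section
/- Let J₁ and J₂ be basic cylinders and let K be a subset of M_a such that there exist surjective d_a-isometries f₁ : J₁ → K and f₂ : J₂ → K. Then J₁ and J₂ have the same elementary volume: vol(J₁) = vol(J₂). -/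
open Filter

noncomputable section

/-- The squared distance `d_a(x,y)²`. -/
def sqDist (a : ℕ → ℝ) (x y : ℕ → ℝ) : ℝ := ∑' i, (a i) ^ 2 * (x i - y i) ^ 2

lemma sqDist_eq_of_da_eq {a x y x' y' : ℕ → ℝ} (h : da a x y = da a x' y') :
    sqDist a x y = sqDist a x' y' :=
  (Real.sqrt_inj (tsum_nonneg fun i => by positivity) (tsum_nonneg fun i => by positivity)).1 h

lemma summable_sq_mul_of_abs_le_one {a u : ℕ → ℝ} (hsum : Summable fun i => (a i) ^ 2)
    (hu : ∀ i, |u i| ≤ 1) : Summable fun i => (a i) ^ 2 * u i := by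
  refine Summable.of_norm_bounded hsum fun i => ?_
  rw [Real.norm_eq_abs, abs_mul, abs_of_nonneg (sq_nonneg (a i))]
  exact mul_le_of_le_one_right (sq_nonneg _) (hu i)

lemma abs_sub_le_one_of_mem_cylSet {lo hi x y : ℕ → ℝ} (h : IsBCData lo hi)
    (hx : x ∈ cylSet lo hi) (hy : y ∈ cylSet lo hi) (i : ℕ) : |x i - y i| ≤ 1 := by
  obtain ⟨h0, -, h1, -⟩ := h
  have := hx i; have := hy i; have := h0 i; have := h1 i
  simp only [Set.mem_Icc] at *
  rw [abs_le]; constructor <;> linarith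

lemma summable_sq_mul_sub_mul_sub {a lo hi x y z t : ℕ → ℝ}
    (hsum : Summable fun i => (a i) ^ 2) (h : IsBCData lo hi)
    (hx : x ∈ cylSet lo hi) (hy : y ∈ cylSet lo hi) (hz : z ∈ cylSet lo hi)
    (ht : t ∈ cylSet lo hi) : Summable fun i => (a i) ^ 2 * ((x i - y i) * (z i - t i)) := by
  refine summable_sq_mul_of_abs_le_one hsum fun i => ?_
  rw [abs_mul]
  exact mul_le_one₀ (abs_sub_le_one_of_mem_cylSet h hx hy i) (abs_nonneg _)
    (abs_sub_le_one_of_mem_cylSet h hz ht i)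

lemma summable_sq_mul_sub_sq {a lo hi x y : ℕ → ℝ}
    (hsum : Summable fun i => (a i) ^ 2) (h : IsBCData lo hi)
    (hx : x ∈ cylSet lo hi) (hy : y ∈ cylSet lo hi) :
    Summable fun i => (a i) ^ 2 * (x i - y i) ^ 2 := by
  simpa only [sq (_ - _)] using summable_sq_mul_sub_mul_sub hsum h hx hy hx hy

lemma tsum_sq_mul_sub_mul_sub {a lo hi x y w : ℕ → ℝ}
    (hsum : Summable fun i => (a i) ^ 2) (h : IsBCData lo hi)
    (hx : x ∈ cylSet lo hi) (hy : y ∈ cylSet lo hi) (hw : w ∈ cylSet lo hi) :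
    ∑' i, (a i) ^ 2 * ((x i - w i) * (y i - w i)) =
      (sqDist a x w + sqDist a y w - sqDist a x y) / 2 := by
  have h1 := summable_sq_mul_sub_sq hsum h hx hw
  have h2 := summable_sq_mul_sub_sq hsum h hy hw
  have h3 := summable_sq_mul_sub_sq hsum h hx hy
  unfold sqDist
  rw [← h1.tsum_add h2, ← (h1.add h2).tsum_sub h3, ← tsum_div_const]
  exact tsum_congr fun i => by ring

/-- `w` is a vertex of the box `∏ᵢ [lo i, hi i]`. -/
def IsVertex (lo hi w : ℕ → ℝ) : Prop := ∀ i, w i = lo i ∨ w i = hi i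

/-- `x` and `y` differ from `w` on disjoint sets of coordinates. -/
def DisjointFrom (w x y : ℕ → ℝ) : Prop := ∀ i, x i = w i ∨ y i = w i

lemma IsVertex.mem_cylSet {lo hi w : ℕ → ℝ} (h : IsBCData lo hi) (hw : IsVertex lo hi w) :
    w ∈ cylSet lo hi := fun i => by
  rcases hw i with e | e <;> rw [e]
  exacts [⟨le_rfl, h.2.1 i⟩, ⟨h.2.1 i, le_rfl⟩]

lemma disjointFrom_iff_sqDist {a lo hi x y w : ℕ → ℝ} (ha : ∀ i, 0 < a i)
    (hsum : Summable fun i => (a i) ^ 2) (h : IsBCData lo hi) (hw : IsVertex lo hi w)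
    (hx : x ∈ cylSet lo hi) (hy : y ∈ cylSet lo hi) :
    DisjointFrom w x y ↔ sqDist a x w + sqDist a y w - sqDist a x y = 0 := by
  have hwm := hw.mem_cylSet h
  have hnn : ∀ i, 0 ≤ (a i) ^ 2 * ((x i - w i) * (y i - w i)) := fun i => by
    refine mul_nonneg (sq_nonneg _) ?_
    rcases hw i with e | e <;> rw [e]
    · exact mul_nonneg (sub_nonneg.2 (hx i).1) (sub_nonneg.2 (hy i).1)
    · exact mul_nonneg_of_nonpos_of_nonpos (sub_nonpos.2 (hx i).2) (sub_nonpos.2 (hy i).2)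
  have hs := summable_sq_mul_sub_mul_sub hsum h hx hwm hy hwm
  have key := tsum_sq_mul_sub_mul_sub hsum h hx hy hwm
  have : sqDist a x w + sqDist a y w - sqDist a x y = 0 ↔
      ∑' i, (a i) ^ 2 * ((x i - w i) * (y i - w i)) = 0 := by
    rw [key]; constructor <;> intro h <;> linarith
  rw [this, ← hs.hasSum_iff, hasSum_zero_iff_of_nonneg hnn, funext_iff]
  refine forall_congr' fun i => ?_
  simp [(ha i).ne', sub_eq_zero]

/-- The vertex adjacent to the vertex `w` along the `i`-th edge. -/
def adjVertex (lo hi w : ℕ → ℝ) (i : ℕ) : ℕ → ℝ := Function.update w i (lo i + hi i - w i)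

lemma adjVertex_isVertex {lo hi w : ℕ → ℝ} (hw : IsVertex lo hi w) (i : ℕ) :
    IsVertex lo hi (adjVertex lo hi w i) := fun j => by
  by_cases hj : j = i
  · subst hj
    rcases hw j with e | e <;> simp [adjVertex, e]
  · simpa [adjVertex, hj] using hw j

lemma adjVertex_of_ne (lo hi w : ℕ → ℝ) {i j : ℕ} (hj : j ≠ i) :
    adjVertex lo hi w i j = w j := by simp [adjVertex, hj]

lemma sq_adjVertex_self_sub {lo hi w : ℕ → ℝ} (hw : IsVertex lo hi w) (i : ℕ) :
    (adjVertex lo hi w i i - w i) ^ 2 = (hi i - lo i) ^ 2 := by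
  rcases hw i with e | e <;> simp only [adjVertex, Function.update_self, e] <;> ring

lemma adjVertex_self_ne {lo hi w : ℕ → ℝ} (hw : IsVertex lo hi w) {i : ℕ}
    (hi' : lo i < hi i) : adjVertex lo hi w i i ≠ w i := fun e => by
  have := sq_adjVertex_self_sub hw i
  rw [e, sub_self] at this
  nlinarith

lemma sqDist_of_forall_ne {a x w : ℕ → ℝ} {i : ℕ} (h : ∀ j, j ≠ i → x j = w j) :
    sqDist a x w = (a i) ^ 2 * (x i - w i) ^ 2 :=
  tsum_eq_single i fun j hj => by simp [h j hj]

/-- A point of a box lies on an edge at the vertex `w` if, of any two points differing from `w`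
on disjoint sets of coordinates, it is disjoint from at least one. -/
lemma exists_forall_ne_of_disjointFrom {lo hi w x : ℕ → ℝ} (h : IsBCData lo hi)
    (hw : IsVertex lo hi w) (hx : x ∈ cylSet lo hi) (hxw : x ≠ w)
    (hedge : ∀ y ∈ cylSet lo hi, ∀ z ∈ cylSet lo hi, DisjointFrom w y z →
      DisjointFrom w x y ∨ DisjointFrom w x z) :
    ∃ i, x i ≠ w i ∧ ∀ j, j ≠ i → x j = w j := by
  obtain ⟨i, hi'⟩ := Function.ne_iff.1 hxw
  refine ⟨i, hi', fun j hj => by_contra fun hjw => ?_⟩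
  have hlt : ∀ k, x k ≠ w k → lo k < hi k := fun k hk => by
    refine lt_of_le_of_ne (h.2.1 k) fun e => hk ?_
    have h1 := hx k
    have h2 := hw.mem_cylSet h k
    simp only [Set.mem_Icc] at h1 h2
    linarith
  have hd : DisjointFrom w (adjVertex lo hi w i) (adjVertex lo hi w j) := fun k => by
    by_cases hk : k = i
    · exact Or.inr (adjVertex_of_ne _ _ _ (hk ▸ hj.symm))
    · exact Or.inl (adjVertex_of_ne _ _ _ hk)
  rcases hedge _ ((adjVertex_isVertex hw i).mem_cylSet h) _
    ((adjVertex_isVertex hw j).mem_cylSet h) hd with H | H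
  · exact (H i).elim hi' (adjVertex_self_ne hw (hlt i hi'))
  · exact (H j).elim hjw (adjVertex_self_ne hw (hlt j hjw))

/-- `g` and `h` are mutually inverse `d_a`-isometries between the sets `S` and `T`. -/
structure IsIsomPair (a : ℕ → ℝ) (S T : Set (ℕ → ℝ)) (g h : (ℕ → ℝ) → ℕ → ℝ) : Prop where
  mapsTo : ∀ x ∈ S, g x ∈ T
  mapsTo' : ∀ y ∈ T, h y ∈ S
  left_inv : ∀ x ∈ S, h (g x) = x
  right_inv : ∀ y ∈ T, g (h y) = y
  sqDist_map : ∀ x ∈ S, ∀ y ∈ S, sqDist a (g x) (g y) = sqDist a x y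

lemma IsIsomPair.symm {a : ℕ → ℝ} {S T : Set (ℕ → ℝ)} {g h : (ℕ → ℝ) → ℕ → ℝ}
    (H : IsIsomPair a S T g h) : IsIsomPair a T S h g where
  mapsTo := H.mapsTo'
  mapsTo' := H.mapsTo
  left_inv := H.right_inv
  right_inv := H.left_inv
  sqDist_map x hx y hy := by
    rw [← H.sqDist_map _ (H.mapsTo' x hx) _ (H.mapsTo' y hy), H.right_inv x hx, H.right_inv y hy]

lemma sqDist_le_sqDist_lo_hi {a lo hi x y : ℕ → ℝ} (hsum : Summable fun i => (a i) ^ 2)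
    (h : IsBCData lo hi) (hx : x ∈ cylSet lo hi) (hy : y ∈ cylSet lo hi) :
    (∀ i, (a i) ^ 2 * (x i - y i) ^ 2 ≤ (a i) ^ 2 * (lo i - hi i) ^ 2) ∧
      sqDist a x y ≤ sqDist a lo hi := by
  have hlo : lo ∈ cylSet lo hi := fun i => ⟨le_rfl, h.2.1 i⟩
  have hhi : hi ∈ cylSet lo hi := fun i => ⟨h.2.1 i, le_rfl⟩
  have hle : ∀ i, (a i) ^ 2 * (x i - y i) ^ 2 ≤ (a i) ^ 2 * (lo i - hi i) ^ 2 := fun i => by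
    refine mul_le_mul_of_nonneg_left (sq_le_sq.2 ?_) (sq_nonneg _)
    have h1 := hx i
    have h2 := hy i
    simp only [Set.mem_Icc] at h1 h2
    rw [abs_sub_comm (lo i), abs_of_nonneg (sub_nonneg.2 (h.2.1 i)), abs_le]
    constructor <;> linarith
  exact ⟨hle, (summable_sq_mul_sub_sq hsum h hx hy).tsum_le_tsum hle
    (summable_sq_mul_sub_sq hsum h hlo hhi)⟩

/-- A diameter-realizing pair in a box consists of vertices. -/
lemma isVertex_of_sqDist_eq {a lo hi x y : ℕ → ℝ} (ha : ∀ i, 0 < a i)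
    (hsum : Summable fun i => (a i) ^ 2) (h : IsBCData lo hi)
    (hx : x ∈ cylSet lo hi) (hy : y ∈ cylSet lo hi) (hd : sqDist a x y = sqDist a lo hi) :
    IsVertex lo hi x := fun i => by
  have hlo : lo ∈ cylSet lo hi := fun i => ⟨le_rfl, h.2.1 i⟩
  have hhi : hi ∈ cylSet lo hi := fun i => ⟨h.2.1 i, le_rfl⟩
  have hle := (sqDist_le_sqDist_lo_hi hsum h hx hy).1
  have heq : (a i) ^ 2 * (x i - y i) ^ 2 = (a i) ^ 2 * (lo i - hi i) ^ 2 := by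
    refine le_antisymm (hle i) (not_lt.1 fun hlt => hd.not_lt ?_)
    exact Summable.tsum_lt_tsum hle hlt (summable_sq_mul_sub_sq hsum h hx hy)
      (summable_sq_mul_sub_sq hsum h hlo hhi)
  have h1 := hx i
  have h2 := hy i
  simp only [Set.mem_Icc] at h1 h2
  rcases sq_eq_sq_iff_eq_or_eq_neg.1 (mul_left_cancel₀ (pow_pos (ha i) 2).ne' heq) with e | e
  · left; linarith
  · right; linarith

section Boxes

variable {a lo₁ hi₁ lo₂ hi₂ v w : ℕ → ℝ} {g h : (ℕ → ℝ) → ℕ → ℝ}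

lemma IsIsomPair.isVertex_map_lo (ha : ∀ i, 0 < a i)
    (hsum : Summable fun i => (a i) ^ 2) (h₁ : IsBCData lo₁ hi₁) (h₂ : IsBCData lo₂ hi₂)
    (H : IsIsomPair a (cylSet lo₁ hi₁) (cylSet lo₂ hi₂) g h) : IsVertex lo₂ hi₂ (g lo₁) := by
  have hlo₁ : lo₁ ∈ cylSet lo₁ hi₁ := fun i => ⟨le_rfl, h₁.2.1 i⟩
  have hhi₁ : hi₁ ∈ cylSet lo₁ hi₁ := fun i => ⟨h₁.2.1 i, le_rfl⟩
  have hlo₂ : lo₂ ∈ cylSet lo₂ hi₂ := fun i => ⟨le_rfl, h₂.2.1 i⟩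
  have hhi₂ : hi₂ ∈ cylSet lo₂ hi₂ := fun i => ⟨h₂.2.1 i, le_rfl⟩
  refine isVertex_of_sqDist_eq ha hsum h₂ (H.mapsTo _ hlo₁) (H.mapsTo _ hhi₁) (le_antisymm
    (sqDist_le_sqDist_lo_hi hsum h₂ (H.mapsTo _ hlo₁) (H.mapsTo _ hhi₁)).2 ?_)
  rw [H.sqDist_map _ hlo₁ _ hhi₁, ← H.symm.sqDist_map _ hlo₂ _ hhi₂]
  exact (sqDist_le_sqDist_lo_hi hsum h₁ (H.mapsTo' _ hlo₂) (H.mapsTo' _ hhi₂)).2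

lemma IsIsomPair.disjointFrom_map_iff (ha : ∀ i, 0 < a i)
    (hsum : Summable fun i => (a i) ^ 2) (h₁ : IsBCData lo₁ hi₁) (h₂ : IsBCData lo₂ hi₂)
    (H : IsIsomPair a (cylSet lo₁ hi₁) (cylSet lo₂ hi₂) g h)
    (hv : IsVertex lo₁ hi₁ v) (hw : IsVertex lo₂ hi₂ w) (hvw : g v = w)
    {x y : ℕ → ℝ} (hx : x ∈ cylSet lo₁ hi₁) (hy : y ∈ cylSet lo₁ hi₁) :
    DisjointFrom w (g x) (g y) ↔ DisjointFrom v x y := by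
  have hvm := hv.mem_cylSet h₁
  rw [disjointFrom_iff_sqDist ha hsum h₂ hw (H.mapsTo _ hx) (H.mapsTo _ hy),
    disjointFrom_iff_sqDist ha hsum h₁ hv hx hy, ← hvw, H.sqDist_map _ hx _ hvm,
    H.sqDist_map _ hy _ hvm, H.sqDist_map _ hx _ hy]

/-- An isometry of boxes carries edges at a vertex to edges at its image. -/
lemma IsIsomPair.exists_edge (ha : ∀ i, 0 < a i)
    (hsum : Summable fun i => (a i) ^ 2) (h₁ : IsBCData lo₁ hi₁) (h₂ : IsBCData lo₂ hi₂)
    (H : IsIsomPair a (cylSet lo₁ hi₁) (cylSet lo₂ hi₂) g h)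
    (hv : IsVertex lo₁ hi₁ v) (hw : IsVertex lo₂ hi₂ w) (hvw : g v = w)
    {i : ℕ} (hi' : lo₁ i < hi₁ i) :
    ∃ j, (g (adjVertex lo₁ hi₁ v i) j ≠ w j ∧
        ∀ k, k ≠ j → g (adjVertex lo₁ hi₁ v i) k = w k) ∧
      a i * (hi₁ i - lo₁ i) ≤ a j * (hi₂ j - lo₂ j) := by
  have hvm := hv.mem_cylSet h₁
  have hwm := hw.mem_cylSet h₂
  have hE := (adjVertex_isVertex hv i).mem_cylSet h₁
  have hgE := H.mapsTo _ hE
  have hne : g (adjVertex lo₁ hi₁ v i) ≠ w := fun e => adjVertex_self_ne hv hi' <| by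
    rw [← H.left_inv _ hE, e, ← hvw, H.left_inv _ hvm]
  obtain ⟨j, hj, hjk⟩ := exists_forall_ne_of_disjointFrom h₂ hw hgE hne <| by
    intro y hy z hz hyz
    rw [← H.right_inv y hy, ← H.right_inv z hz] at hyz ⊢
    have hy' := H.mapsTo' y hy
    have hz' := H.mapsTo' z hz
    rw [H.disjointFrom_map_iff ha hsum h₁ h₂ hv hw hvw hy' hz'] at hyz
    rw [H.disjointFrom_map_iff ha hsum h₁ h₂ hv hw hvw hE hy',
      H.disjointFrom_map_iff ha hsum h₁ h₂ hv hw hvw hE hz']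
    refine (hyz i).imp (fun e k => ?_) (fun e k => ?_) <;>
    · by_cases hk : k = i
      · exact Or.inr (hk ▸ e)
      · exact Or.inl (adjVertex_of_ne _ _ _ hk)
  refine ⟨j, ⟨hj, hjk⟩, ?_⟩
  have hdist := H.sqDist_map _ hE _ hvm
  rw [hvw, sqDist_of_forall_ne hjk,
    sqDist_of_forall_ne (fun k hk => adjVertex_of_ne lo₁ hi₁ v hk),
    sq_adjVertex_self_sub hv, ← mul_pow, ← mul_pow] at hdist
  have hle : |a j * (g (adjVertex lo₁ hi₁ v i) j - w j)| ≤ a j * (hi₂ j - lo₂ j) := by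
    rw [abs_mul, abs_of_pos (ha j)]
    refine mul_le_mul_of_nonneg_left ?_ (ha j).le
    have h3 := hgE j
    have h4 := hwm j
    simp only [Set.mem_Icc] at h3 h4
    rw [abs_le]
    constructor <;> linarith
  exact (le_abs_self _).trans ((sq_eq_sq_iff_abs_eq_abs _ _).1 hdist ▸ hle)

/-- Isometric boxes have the same nondegenerate edge lengths, up to a permutation. -/
lemma IsIsomPair.exists_edge_matching (ha : ∀ i, 0 < a i)
    (hsum : Summable fun i => (a i) ^ 2) (h₁ : IsBCData lo₁ hi₁) (h₂ : IsBCData lo₂ hi₂)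
    (H : IsIsomPair a (cylSet lo₁ hi₁) (cylSet lo₂ hi₂) g h) :
    ∃ σ τ : ℕ → ℕ,
      (∀ i, lo₁ i < hi₁ i → a (σ i) * (hi₂ (σ i) - lo₂ (σ i)) = a i * (hi₁ i - lo₁ i) ∧
        τ (σ i) = i) ∧
      (∀ i, lo₂ i < hi₂ i → a (τ i) * (hi₁ (τ i) - lo₁ (τ i)) = a i * (hi₂ i - lo₂ i) ∧
        σ (τ i) = i) := by
  have hv : IsVertex lo₁ hi₁ lo₁ := fun i => Or.inl rfl
  have hw := H.isVertex_map_lo ha hsum h₁ h₂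
  have hwv : h (g lo₁) = lo₁ := H.left_inv _ (hv.mem_cylSet h₁)
  generalize hvw : g lo₁ = w at hw hwv
  have e₁ := fun i (hi' : lo₁ i < hi₁ i) => H.exists_edge ha hsum h₁ h₂ hv hw hvw hi'
  have e₂ := fun i (hi' : lo₂ i < hi₂ i) => H.symm.exists_edge ha hsum h₂ h₁ hw hv hwv hi'
  choose! σ hσ hσle using e₁
  choose! τ hτ hτle using e₂
  have posσ : ∀ i, lo₁ i < hi₁ i → lo₂ (σ i) < hi₂ (σ i) := fun i hi' =>
    sub_pos.1 (pos_of_mul_pos_right ((mul_pos (ha i) (sub_pos.2 hi')).trans_le (hσle i hi'))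
      (ha _).le)
  have posτ : ∀ i, lo₂ i < hi₂ i → lo₁ (τ i) < hi₁ (τ i) := fun i hi' =>
    sub_pos.1 (pos_of_mul_pos_right ((mul_pos (ha i) (sub_pos.2 hi')).trans_le (hτle i hi'))
      (ha _).le)
  have linv : ∀ i, lo₁ i < hi₁ i → τ (σ i) = i := fun i hi' => by
    by_contra hne
    have hE := (adjVertex_isVertex hv i).mem_cylSet h₁
    have hE' := (adjVertex_isVertex hw (σ i)).mem_cylSet h₂
    have hd : DisjointFrom w (g (adjVertex lo₁ hi₁ lo₁ i))
        (g (h (adjVertex lo₂ hi₂ w (σ i)))) := by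
      rw [H.disjointFrom_map_iff ha hsum h₁ h₂ hv hw hvw hE (H.mapsTo' _ hE')]
      intro k
      by_cases hk : k = i
      · exact Or.inr ((hτ _ (posσ i hi')).2 k fun e => hne (e.symm.trans hk))
      · exact Or.inl (adjVertex_of_ne _ _ _ hk)
    rw [H.right_inv _ hE'] at hd
    exact (hd (σ i)).elim (hσ i hi').1 (adjVertex_self_ne hw (posσ i hi'))
  have rinv : ∀ i, lo₂ i < hi₂ i → σ (τ i) = i := fun i hi' => by
    by_contra hne
    have hE := (adjVertex_isVertex hw i).mem_cylSet h₂
    have hE' := (adjVertex_isVertex hv (τ i)).mem_cylSet h₁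
    have hd : DisjointFrom lo₁ (h (adjVertex lo₂ hi₂ w i))
        (h (g (adjVertex lo₁ hi₁ lo₁ (τ i)))) := by
      rw [H.symm.disjointFrom_map_iff ha hsum h₂ h₁ hw hv hwv hE (H.mapsTo _ hE')]
      intro k
      by_cases hk : k = i
      · exact Or.inr ((hσ _ (posτ i hi')).2 k fun e => hne (e.symm.trans hk))
      · exact Or.inl (adjVertex_of_ne _ _ _ hk)
    rw [H.left_inv _ hE'] at hd
    exact (hd (τ i)).elim (hτ i hi').1 (adjVertex_self_ne hv (posτ i hi'))
  refine ⟨σ, τ, fun i hi' => ⟨le_antisymm ?_ (hσle i hi'), linv i hi'⟩,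
    fun i hi' => ⟨le_antisymm ?_ (hτle i hi'), rinv i hi'⟩⟩
  · simpa only [linv i hi'] using hτle _ (posσ i hi')
  · simpa only [rinv i hi'] using hσle _ (posτ i hi')

end Boxes

/-- Two families of edge lengths that agree with `1` off a finite set have equal products if,
after scaling by a null sequence `a`, their positive parts agree up to a permutation. -/
lemma finprod_eq_of_matching {a l m : ℕ → ℝ} (ha : ∀ i, 0 < a i) (ha0 : Tendsto a atTop (nhds 0))
    (hl : ∀ i, 0 ≤ l i) (hm : ∀ i, 0 ≤ m i) {F : Finset ℕ} (hlF : ∀ i, i ∉ F → l i = 1)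
    (hmF : ∀ i, i ∉ F → m i = 1) {σ τ : ℕ → ℕ}
    (hσ : ∀ i, 0 < l i → a (σ i) * m (σ i) = a i * l i ∧ τ (σ i) = i)
    (hτ : ∀ i, 0 < m i → a (τ i) * l (τ i) = a i * m i ∧ σ (τ i) = i) :
    ∏ᶠ i, l i = ∏ᶠ i, m i := by
  classical
  obtain ⟨ε, hε, hεl, hεm⟩ : ∃ ε > 0, (∀ i ∈ F, 0 < l i → ε ≤ a i * l i) ∧
      (∀ i ∈ F, 0 < m i → ε ≤ a i * m i) := by
    have key : ∀ u : ℕ → ℝ, ∀ᶠ ε in nhdsWithin (0 : ℝ) (Set.Ioi 0),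
        ∀ i ∈ F, 0 < u i → ε ≤ a i * u i := fun u => by
      refine (Finset.eventually_all F).2 fun i _ => ?_
      by_cases hu : 0 < u i
      · filter_upwards [Ioc_mem_nhdsGT (mul_pos (ha i) hu)] with ε hε _ using hε.2
      · exact Eventually.of_forall fun _ h => absurd h hu
    obtain ⟨ε, h1, h2, h3⟩ := ((key l).and ((key m).and self_mem_nhdsWithin)).exists
    exact ⟨ε, h3, h1, h2⟩
  have hfin : {i | ε ≤ a i}.Finite := by
    have := (ha0.eventually (gt_mem_nhds hε))
    rw [← Nat.cofinite_eq_atTop, eventually_cofinite] at this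
    simpa using this
  set G : Finset ℕ := F ∪ hfin.toFinset with hG
  have hlG : ∀ i, i ∉ G → l i = 1 := fun i hi => hlF i fun h => hi (by simp [hG, h])
  have hmG : ∀ i, i ∉ G → m i = 1 := fun i hi => hmF i fun h => hi (by simp [hG, h])
  have mem_iff : ∀ u : ℕ → ℝ, (∀ i, i ∉ F → u i = 1) → (∀ i ∈ F, 0 < u i → ε ≤ a i * u i) →
      ∀ i, i ∈ G.filter (fun i => 0 < u i) ↔ 0 < u i ∧ ε ≤ a i * u i := by
    intro u hu1 hu2 i
    rw [Finset.mem_filter, and_comm]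
    refine and_congr_right fun hpos => ?_
    by_cases hF : i ∈ F
    · simp [hG, hF, hu2 i hF hpos]
    · simp [hG, hF, hu1 i hF]
  have pos_of : ∀ u : ℕ → ℝ, ∀ i, ε ≤ a i * u i → 0 < u i := fun u i h =>
    pos_of_mul_pos_right (hε.trans_le h) (ha i).le
  have mapσ : ∀ i ∈ G.filter (fun i => 0 < l i), σ i ∈ G.filter (fun i => 0 < m i) := by
    intro i hi
    obtain ⟨h1, h2⟩ := (mem_iff l hlF hεl i).1 hi
    rw [← (hσ i h1).1] at h2
    exact (mem_iff m hmF hεm _).2 ⟨pos_of m _ h2, h2⟩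
  have mapτ : ∀ i ∈ G.filter (fun i => 0 < m i), τ i ∈ G.filter (fun i => 0 < l i) := by
    intro i hi
    obtain ⟨h1, h2⟩ := (mem_iff m hmF hεm i).1 hi
    rw [← (hτ i h1).1] at h2
    exact (mem_iff l hlF hεl _).2 ⟨pos_of l _ h2, h2⟩
  have hcard : (G.filter fun i => 0 < l i).card = (G.filter fun i => 0 < m i).card :=
    Finset.card_bij' (fun i _ => σ i) (fun i _ => τ i) mapσ mapτ
      (fun i hi => (hσ i (Finset.mem_filter.1 hi).2).2)
      (fun i hi => (hτ i (Finset.mem_filter.1 hi).2).2)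
  have hprod : ∏ i ∈ G.filter (fun i => 0 < l i), a i * l i =
      ∏ i ∈ G.filter (fun i => 0 < m i), a i * m i :=
    Finset.prod_bij' (fun i _ => σ i) (fun i _ => τ i) mapσ mapτ
      (fun i hi => (hσ i (Finset.mem_filter.1 hi).2).2)
      (fun i hi => (hτ i (Finset.mem_filter.1 hi).2).2)
      (fun i hi => (hσ i (Finset.mem_filter.1 hi).2).1.symm)
  have finprod_eq : ∀ u : ℕ → ℝ, (∀ i, i ∉ G → u i = 1) → ∏ᶠ i, u i = ∏ i ∈ G, u i :=
    fun u hu => finprod_eq_prod_of_mulSupport_subset u fun i hi => by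
      by_contra h
      exact hi (hu i h)
  rw [finprod_eq l hlG, finprod_eq m hmG]
  by_cases hall : ∀ i ∈ G, 0 < l i
  · have hl' : G.filter (fun i => 0 < l i) = G := Finset.filter_true_of_mem hall
    have hm' : G.filter (fun i => 0 < m i) = G :=
      Finset.eq_of_subset_of_card_le (Finset.filter_subset _ _) (by rw [← hcard, hl'])
    rw [hl', hm', Finset.prod_mul_distrib, Finset.prod_mul_distrib] at hprod
    exact mul_left_cancel₀ (Finset.prod_pos fun i _ => ha i).ne' hprod
  · have hall' : ¬ ∀ i ∈ G, 0 < m i := fun hm' => hall <| by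
      rw [Finset.filter_true_of_mem hm', Finset.card_filter_eq_iff] at hcard
      exact hcard
    push Not at hall hall'
    obtain ⟨i, hi, hi0⟩ := hall
    obtain ⟨j, hj, hj0⟩ := hall'
    rw [Finset.prod_eq_zero hi (le_antisymm hi0 (hl i)),
      Finset.prod_eq_zero hj (le_antisymm hj0 (hm j))]

lemma eq_of_da_eq_zero {a lo hi x y : ℕ → ℝ} (ha : ∀ i, 0 < a i)
    (hsum : Summable fun i => (a i) ^ 2) (h : IsBCData lo hi)
    (hx : x ∈ cylSet lo hi) (hy : y ∈ cylSet lo hi) (hd : da a x y = 0) : x = y := by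
  have hnn : ∀ i, 0 ≤ (a i) ^ 2 * (x i - y i) ^ 2 := fun i => by positivity
  have h0 := (Real.sqrt_eq_zero (tsum_nonneg hnn)).1 hd
  rw [← (summable_sq_mul_sub_sq hsum h hx hy).hasSum_iff, hasSum_zero_iff_of_nonneg hnn] at h0
  funext i
  simpa [(ha i).ne', sub_eq_zero] using congrFun h0 i

lemma IsIsomOn.injOn_cylSet {a lo hi : ℕ → ℝ} {f : (ℕ → ℝ) → ℕ → ℝ} (ha : ∀ i, 0 < a i)
    (hsum : Summable fun i => (a i) ^ 2) (h : IsBCData lo hi)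
    (hf : IsIsomOn a f (cylSet lo hi)) : Set.InjOn f (cylSet lo hi) := fun x hx y hy e =>
  eq_of_da_eq_zero ha hsum h hx hy <| by rw [← hf x hx y hy, e]; simp [da]

lemma exists_isIsomPair {a lo₁ hi₁ lo₂ hi₂ : ℕ → ℝ} {f₁ f₂ : (ℕ → ℝ) → ℕ → ℝ}
    (ha : ∀ i, 0 < a i) (hsum : Summable fun i => (a i) ^ 2)
    (h₁ : IsBCData lo₁ hi₁) (h₂ : IsBCData lo₂ hi₂)
    (hf₁ : IsIsomOn a f₁ (cylSet lo₁ hi₁)) (hf₂ : IsIsomOn a f₂ (cylSet lo₂ hi₂))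
    (hK : f₁ '' cylSet lo₁ hi₁ = f₂ '' cylSet lo₂ hi₂) :
    ∃ g h, IsIsomPair a (cylSet lo₁ hi₁) (cylSet lo₂ hi₂) g h := by
  have hg : ∀ x ∈ cylSet lo₁ hi₁, ∃ y ∈ cylSet lo₂ hi₂, f₂ y = f₁ x := fun x hx =>
    hK.subset (Set.mem_image_of_mem f₁ hx)
  have hh : ∀ y ∈ cylSet lo₂ hi₂, ∃ x ∈ cylSet lo₁ hi₁, f₁ x = f₂ y := fun y hy =>
    hK.symm.subset (Set.mem_image_of_mem f₂ hy)
  choose! g hgm hg using hg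
  choose! h hhm hh using hh
  refine ⟨g, h, hgm, hhm, fun x hx => ?_, fun y hy => ?_, fun x hx y hy => ?_⟩
  · exact hf₁.injOn_cylSet ha hsum h₁ (hhm _ (hgm x hx)) hx (by rw [hh _ (hgm x hx), hg x hx])
  · exact hf₂.injOn_cylSet ha hsum h₂ (hgm _ (hhm y hy)) hy (by rw [hg _ (hhm y hy), hh y hy])
  · refine sqDist_eq_of_da_eq ?_
    rw [← hf₂ _ (hgm x hx) _ (hgm y hy), hg x hx, hg y hy, hf₁ x hx y hy]

/-- Two basic cylinders that are `d_a`-isometric to the same set `K` have the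
same elementary volume. -/
theorem ulam_stmt12 (a : ℕ → ℝ) (ha : ∀ i, 0 < a i)
    (hsum : Summable fun i => (a i) ^ 2)
    (lo₁ hi₁ lo₂ hi₂ : ℕ → ℝ) (h₁ : IsBCData lo₁ hi₁) (h₂ : IsBCData lo₂ hi₂)
    (K : Set (ℕ → ℝ)) (f₁ f₂ : (ℕ → ℝ) → ℕ → ℝ)
    (hf₁ : IsIsomOn a f₁ (cylSet lo₁ hi₁)) (hf₁s : f₁ '' cylSet lo₁ hi₁ = K)
    (hf₂ : IsIsomOn a f₂ (cylSet lo₂ hi₂)) (hf₂s : f₂ '' cylSet lo₂ hi₂ = K) :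
    bcVol lo₁ hi₁ = bcVol lo₂ hi₂ := by
  obtain ⟨g, h, H⟩ := exists_isIsomPair ha hsum h₁ h₂ hf₁ hf₂ (hf₁s.trans hf₂s.symm)
  obtain ⟨σ, τ, hσ, hτ⟩ := H.exists_edge_matching ha hsum h₁ h₂
  have ha0 : Tendsto a atTop (nhds 0) := by
    have := hsum.tendsto_atTop_zero.sqrt
    simpa only [Real.sqrt_sq (ha _).le, Real.sqrt_zero] using this
  have len_eq_one : ∀ i, i ∉ h₁.2.2.2.toFinset ∪ h₂.2.2.2.toFinset →
      hi₁ i - lo₁ i = 1 ∧ hi₂ i - lo₂ i = 1 := fun i hi => by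
    simp only [Finset.mem_union, Set.Finite.mem_toFinset, Set.mem_ofPred_eq, not_or,
      not_not] at hi
    simp [hi.1, hi.2]
  exact finprod_eq_of_matching (l := fun i => hi₁ i - lo₁ i) (m := fun i => hi₂ i - lo₂ i)
    ha ha0 (fun i => sub_nonneg.2 (h₁.2.1 i)) (fun i => sub_nonneg.2 (h₂.2.1 i))
    (fun i hi => (len_eq_one i hi).1) (fun i hi => (len_eq_one i hi).2)
    (fun i hi => hσ i (sub_pos.1 hi)) (fun i hi => hτ i (sub_pos.1 hi))
end
end

section
/- μ(I^ω) ≤ 1, where I^ω = [0,1]^ℕ is the Hilbert cube regarded as a subset of M_a. -/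
open Filter

noncomputable section

/-- A set whose edges are at most `w` in the first `M` coordinates and at most `1` elsewhere has
diameter controlled by `w` and the tail of `∑ aᵢ²`. -/
theorem da_le_of_edges {a : ℕ → ℝ} (hsum : Summable fun i => (a i) ^ 2) {M : ℕ} {w : ℝ}
    {x y : ℕ → ℝ} (h₁ : ∀ i < M, |x i - y i| ≤ w) (h₂ : ∀ i, |x i - y i| ≤ 1) :
    da a x y ≤ Real.sqrt ((∑' i, (a i) ^ 2) * w ^ 2 + ∑' i, (a (i + M)) ^ 2) := by
  have hle : ∀ i, (a i) ^ 2 * (x i - y i) ^ 2 ≤ (a i) ^ 2 := fun i =>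
    mul_le_of_le_one_right (sq_nonneg _) ((sq_le_one_iff_abs_le_one _).2 (h₂ i))
  have hs : Summable fun i => (a i) ^ 2 * (x i - y i) ^ 2 :=
    hsum.of_nonneg_of_le (fun i => by positivity) hle
  refine Real.sqrt_le_sqrt ?_
  rw [← hs.sum_add_tsum_nat_add M]
  refine add_le_add ?_ ?_
  · calc ∑ i ∈ Finset.range M, (a i) ^ 2 * (x i - y i) ^ 2
        ≤ ∑ i ∈ Finset.range M, (a i) ^ 2 * w ^ 2 := by
          refine Finset.sum_le_sum fun i hi => mul_le_mul_of_nonneg_left ?_ (sq_nonneg _)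
          exact sq_le_sq.2 ((h₁ i (Finset.mem_range.1 hi)).trans (le_abs_self w))
      _ = (∑ i ∈ Finset.range M, (a i) ^ 2) * w ^ 2 := (Finset.sum_mul _ _ _).symm
      _ ≤ _ := mul_le_mul_of_nonneg_right
          (hsum.sum_le_tsum _ fun i _ => sq_nonneg _) (sq_nonneg _)
  · exact ((summable_nat_add_iff M).2 hs).tsum_le_tsum (fun i => hle (i + M))
      ((summable_nat_add_iff M).2 hsum)

/-- Covering the cube by the `k ^ M` subcubes obtained by cutting each of the first `M` edges
into `k` equal pieces, padded with null cylinders. -/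
theorem preMu_cube_le_one {a : ℕ → ℝ} {δ : ℝ} {k M : ℕ} (hk : 0 < k) (hM : 0 < M)
    (hdiam : ∀ x y : ℕ → ℝ, (∀ i < M, |x i - y i| ≤ 1 / k) → (∀ i, |x i - y i| ≤ 1) →
      da a x y ≤ δ / 2) (hδ : 0 < δ) :
    preMu a δ cube ≤ 1 := by
  have hk' : (0 : ℝ) < k := by exact_mod_cast hk
  have hkM : 0 < k ^ M := pow_pos hk M
  let c : ℕ → Fin M → Fin k := fun n => finFunctionFinEquiv.symm ⟨n % k ^ M, Nat.mod_lt _ hkM⟩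
  let w : ℕ → ℝ := fun n => if n < k ^ M then 1 / k else 0
  have hw0 : ∀ n, 0 ≤ w n := fun n => by dsimp only [w]; split_ifs <;> positivity
  have hw1 : ∀ n, w n ≤ 1 / k := fun n => by
    dsimp only [w]; split_ifs
    · exact le_rfl
    · positivity
  let lo : ℕ → ℕ → ℝ := fun n i => if h : i < M then (c n ⟨i, h⟩ : ℕ) / k else 0
  let hi : ℕ → ℕ → ℝ := fun n i => if i < M then lo n i + w n else 1
  have hlo : ∀ n i, 0 ≤ lo n i := fun n i => by dsimp only [lo]; split_ifs <;> positivity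
  have hlohi : ∀ n i, lo n i ≤ hi n i := fun n i => by
    by_cases h : i < M
    · simp [hi, h, hw0]
    · simp [hi, lo, h]
  have hhi : ∀ n i, hi n i ≤ 1 := fun n i => by
    by_cases h : i < M
    · have h1 : ((c n ⟨i, h⟩ : ℕ) : ℝ) + 1 ≤ k := by exact_mod_cast (c n ⟨i, h⟩).2
      have h2 : hi n i = (c n ⟨i, h⟩ : ℕ) / k + w n := by simp [hi, lo, h]
      have h3 : ((c n ⟨i, h⟩ : ℕ) : ℝ) / k + 1 / k ≤ 1 := by
        rw [← add_div]; exact (div_le_one hk').2 h1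
      linarith [hw1 n]
    · simp [hi, h]
  have hdata : ∀ n, IsBCData (lo n) (hi n) := fun n => by
    refine ⟨hlo n, hlohi n, hhi n, (Set.finite_lt_nat M).subset fun i h => ?_⟩
    by_contra h'
    exact h ⟨by simp only [lo]; exact dif_neg h', if_neg h'⟩
  have hvol : ∀ n, bcVol (lo n) (hi n) = w n ^ M := fun n => by
    have hsupp : Function.mulSupport (fun i => hi n i - lo n i) ⊆ Finset.range M := fun i h => by
      by_contra h'
      have h' : ¬ i < M := by simpa using h'
      exact h (by simp [hi, lo, h'])
    rw [bcVol, finprod_eq_prod_of_mulSupport_subset _ hsupp, Finset.prod_congr rfl (g := fun _ => w n)]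
    · simp
    · intro i h
      simp [hi, Finset.mem_range.1 h]
  refine sInf_le_of_le ⟨fun n => cylSet (lo n) (hi n), fun n => w n ^ M, fun n =>
    ⟨lo n, hi n, hdata n, (hvol n).symm, id, fun _ _ _ _ => rfl, Set.image_id _⟩,
    fun n => ?_, fun x hx => ?_, rfl⟩ ?_
  · refine (Real.sSup_le ?_ (by positivity)).trans_lt (half_lt_self hδ)
    rintro _ ⟨x, hx, y, hy, rfl⟩
    refine hdiam x y (fun i h => ?_) fun i => ?_
    · have hx := hx i
      have hy := hy i
      simp only [hi, if_pos h, Set.mem_Icc] at hx hy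
      rw [abs_sub_le_iff]
      constructor <;> linarith [hw1 n]
    · rw [abs_sub_le_iff]
      constructor <;> linarith [(hx i).1, (hx i).2, (hy i).1, (hy i).2, hlo n i, hhi n i]
  · have hex : ∀ i, ∃ j : Fin k, ((j : ℕ) : ℝ) / k ≤ x i ∧ x i ≤ ((j : ℕ) : ℝ) / k + 1 / k := by
      intro i
      obtain ⟨h0, h1⟩ := hx i
      rcases h1.lt_or_eq with h1 | h1
      · have hxk : 0 ≤ x i * k := by positivity
        refine ⟨⟨⌊x i * k⌋₊, (Nat.floor_lt hxk).2 (by nlinarith)⟩, ?_, ?_⟩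
        · exact (div_le_iff₀ hk').2 (Nat.floor_le hxk)
        · rw [← add_div, le_div_iff₀ hk']
          exact (Nat.lt_floor_add_one _).le
      · refine ⟨⟨k - 1, by omega⟩, ?_, ?_⟩
        · rw [h1, div_le_one hk']
          exact_mod_cast Nat.sub_le k 1
        · rw [h1, ← add_div, le_div_iff₀ hk', one_mul]
          exact_mod_cast (by omega : k ≤ k - 1 + 1)
    choose j hj using hex
    let m : Fin (k ^ M) := finFunctionFinEquiv fun i : Fin M => j i
    refine Set.mem_iUnion.2 ⟨m, fun i => ?_⟩
    by_cases h : i < M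
    · have hc : c m = fun i : Fin M => j i := by
        simp only [c, Nat.mod_eq_of_lt m.2, Fin.eta]
        exact finFunctionFinEquiv.symm_apply_apply _
      have hl : lo m i = (j i : ℕ) / k := by simp [lo, h, hc]
      have hh : hi m i = (j i : ℕ) / k + 1 / k := by
        simp only [hi, if_pos h, hl, w, if_pos m.2]
      rw [hl, hh]
      exact hj i
    · simpa [lo, hi, h] using hx i
  · rw [tsum_eq_sum (s := Finset.range (k ^ M)) fun n hn => by
        simp [w, Finset.mem_range.not.1 hn, hM.ne'], ← ENNReal.ofReal_sum_of_nonneg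
        fun n _ => pow_nonneg (hw0 n) M,
      Finset.sum_congr rfl (g := fun _ => (1 / (k : ℝ)) ^ M) fun n hn => by
        simp only [w, if_pos (Finset.mem_range.1 hn)]]
    simp [hk'.ne']

/-- `μ(I^ω) ≤ 1`. -/
theorem ulam_stmt13 (a : ℕ → ℝ) (ha : ∀ i, 0 < a i)
    (hsum : Summable fun i => (a i) ^ 2) :
    muA a cube ≤ 1 := by
  refine iSup₂_le fun δ hδ => ?_
  have hpos : 0 < (δ / 2) ^ 2 / 2 := by positivity
  obtain ⟨M, hMt, hM⟩ := (((tendsto_sum_nat_add fun i => (a i) ^ 2).eventually_lt_const hpos).and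
    (eventually_gt_atTop 0)).exists
  have hlim : Tendsto (fun k : ℕ => (∑' i, (a i) ^ 2) * (1 / (k : ℝ)) ^ 2) atTop (nhds 0) := by
    simpa using (tendsto_one_div_atTop_nhds_zero_nat (𝕜 := ℝ)).pow 2 |>.const_mul
      (∑' i, (a i) ^ 2)
  obtain ⟨k, hkt, hk⟩ := ((hlim.eventually_lt_const hpos).and (eventually_gt_atTop 0)).exists
  refine preMu_cube_le_one hk hM (fun x y h₁ h₂ => ?_) hδ
  refine (da_le_of_edges hsum h₁ h₂).trans ?_
  exact Real.sqrt_le_iff.2 ⟨by positivity, by linarith⟩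
end
end
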